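/- Let g: ℝ^m → ℝ^q be twice continuously differentiable, Γ := {y ∈ ℝ^m | g(y) ≤ 0}, ȳ ∈ Γ, and suppose the metric subregularity constraint qualification holds for the system g(y) ≤ 0 at ȳ. Then there exists κ' > 0 such that for every y ∈ Γ sufficiently close to ȳ, every y* ∈ N̂_Γ(y), and every v ∈ K(y, y*), the set Λ(y, y*; v) ∩ E(y, y*) ∩ {λ | ‖λ‖ ≤ κ'‖y*‖} is nonempty. -/

import Mathlib

open Filter Topology Set
open scoped RealInnerProductSpace

noncomputable section

/-- `ℝ^d` as a Euclidean space. -/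
abbrev Eu (d : ℕ) := EuclideanSpace ℝ (Fin d)

/-- The (Bouligand–Severi) tangent/contingent cone to `Ω` at `z`. -/
def tcone {E : Type*} [NormedAddCommGroup E] [NormedSpace ℝ E] (Ω : Set E) (z : E) : Set E :=
  {u | ∃ t : ℕ → ℝ, ∃ w : ℕ → E, (∀ k, 0 < t k) ∧
    Tendsto t atTop (𝓝 0) ∧ Tendsto w atTop (𝓝 u) ∧ ∀ k, z + t k • w k ∈ Ω}

/-- The (Fréchet) regular normal cone to `Ω` at `zb`. -/
def rnc {E : Type*} [NormedAddCommGroup E] [InnerProductSpace ℝ E]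
    (Ω : Set E) (zb : E) : Set E :=
  {v | ∀ ε > (0 : ℝ), ∃ δ > (0 : ℝ), ∀ z ∈ Ω, ‖z - zb‖ < δ →
    ⟪v, z - zb⟫ ≤ ε * ‖z - zb‖}

/-- Metric subregularity of a set-valued map at a point of its graph. -/
def msr {E F : Type*} [NormedAddCommGroup E] [NormedAddCommGroup F]
    (M : E → Set F) (zb : E) (wb : F) : Prop :=
  ∃ κ : ℝ, 0 < κ ∧ ∃ W ∈ 𝓝 zb, ∀ z ∈ W,
    EMetric.infEdist z {z' | wb ∈ M z'} ≤ ENNReal.ofReal κ * EMetric.infEdist wb (M z)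

/-- The lower-level feasible set `Γ = {y | g(y) ≤ 0}`. -/
def Gam {m q : ℕ} (g : Eu m → Eu q) : Set (Eu m) := {y | ∀ i, g y i ≤ 0}

/-- The multiplier set `Λ(y, y*) = {λ ≥ 0 | ∇g(y)ᵀλ = y*, λ_i = 0 for i ∉ I(y)}`. -/
def Lam {m q : ℕ} (g : Eu m → Eu q) (y ys : Eu m) : Set (Eu q) :=
  {l | (∀ i, 0 ≤ l i) ∧ ContinuousLinearMap.adjoint (fderiv ℝ g y) l = ys ∧
    ∀ i, g y i ≠ 0 → l i = 0}

/-- The critical cone `K(y, y*) = T_Γ(y) ∩ {y*}ᗮ`. -/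
def Kcone {m q : ℕ} (g : Eu m → Eu q) (y ys : Eu m) : Set (Eu m) :=
  tcone (Gam g) y ∩ {v | ⟪v, ys⟫ = 0}

/-- The convex-analysis normal cone to a (convex) set `Ω` at `z`. -/
def cnc {E : Type*} [NormedAddCommGroup E] [InnerProductSpace ℝ E]
    (Ω : Set E) (z : E) : Set E :=
  {w | ∀ z' ∈ Ω, ⟪w, z' - z⟫ ≤ 0}

/-- `∇²(λᵀg)(y) v`, the Hessian of `y ↦ ⟨λ, g(y)⟩` applied to `v`, realized as the
derivative at `y` of the gradient map `y' ↦ ∇g(y')ᵀλ` in the direction `v`. -/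
def hessA {m q : ℕ} (g : Eu m → Eu q) (l : Eu q) (y v : Eu m) : Eu m :=
  fderiv ℝ (fun y' => ContinuousLinearMap.adjoint (fderiv ℝ g y') l) y v

/-- The directional multiplier set
`Λ(y, y*; v) = argmax {vᵀ∇²(λᵀg)(y)v | λ ∈ Λ(y, y*)}`. -/
def dirLam {m q : ℕ} (g : Eu m → Eu q) (y ys v : Eu m) : Set (Eu q) :=
  {l | l ∈ Lam g y ys ∧ ∀ l' ∈ Lam g y ys, ⟪v, hessA g l' y v⟫ ≤ ⟪v, hessA g l y v⟫}

/-- The extreme points `E(y, y*)` of `Λ(y, y*)`: those multipliers `λ` for which the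
active gradients `{∇g_i(y) | λ_i > 0}` are linearly independent. -/
def ExtPts {m q : ℕ} (g : Eu m → Eu q) (y ys : Eu m) : Set (Eu q) :=
  {l | l ∈ Lam g y ys ∧
    LinearIndependent ℝ (fun i : {i : Fin q // 0 < l i} =>
      fderiv ℝ (fun y' => g y' i.1) y)}

/-- The graph of the regular normal cone map `y ↦ N̂_Γ(y)`. -/
def gphN {m q : ℕ} (g : Eu m → Eu q) : Set (Eu m × Eu m) :=
  {p | p.1 ∈ Gam g ∧ p.2 ∈ rnc (Gam g) p.1}

/-- MSCQ for the lower-level system `g(y) ≤ 0` at `yb`: metric subregularity of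
`y ↦ g(y) − ℝ^q₋` at `(yb, 0)`. -/
def MSCQlow {m q : ℕ} (g : Eu m → Eu q) (yb : Eu m) : Prop :=
  msr (fun y => {w : Eu q | ∀ i, g y i - w i ≤ 0}) yb 0

theorem ContDiff.taylor_two_isLittleO {E F : Type*} [NormedAddCommGroup E] [NormedSpace ℝ E]
    [NormedAddCommGroup F] [NormedSpace ℝ F] {f : E → F} (hf : ContDiff ℝ 2 f) (y : E) :
    (fun x => f x - f y - fderiv ℝ f y (x - y)
      - (1 / 2 : ℝ) • fderiv ℝ (fderiv ℝ f) y (x - y) (x - y)) =o[𝓝 y]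
        fun x => ‖x - y‖ ^ 2 := by
  set A := fderiv ℝ f y
  set D := fderiv ℝ (fderiv ℝ f) y with hD
  have hsymm : ∀ v w, D v w = D w v :=
    hf.contDiffAt.isSymmSndFDerivAt (by simp)
  have hdf : Differentiable ℝ f := hf.differentiable (by norm_num)
  have hddf : Differentiable ℝ (fderiv ℝ f) :=
    (hf.fderiv_right (m := 1) (by norm_num)).differentiable (by norm_num)
  have hderiv : ∀ x, HasFDerivAt (fun x => f x - f y - A (x - y) - (1 / 2 : ℝ) • D (x - y) (x - y))
      (fderiv ℝ f x - A - D (x - y)) x := by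
    intro x
    have h0 : HasFDerivAt (fun x : E => x - y) (ContinuousLinearMap.id ℝ E) x :=
      (hasFDerivAt_id x).sub_const y
    have h1 := ((hdf x).hasFDerivAt.sub_const (f y)).sub (A.hasFDerivAt.comp x h0)
    have h2 := ((D.hasFDerivAt.comp x h0).clm_apply h0).const_smul (1 / 2 : ℝ)
    refine (h1.sub h2).congr_fderiv ?_
    ext w
    simp only [sub_apply, smul_apply,
      add_apply, ContinuousLinearMap.comp_apply,
      ContinuousLinearMap.flip_apply, ContinuousLinearMap.id_apply, Function.comp_apply,
      hsymm w (x - y)]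
    rw [← two_smul ℝ (D (x - y) w), smul_smul]
    norm_num
  have hlo : (fun x => fderiv ℝ f x - A - D (x - y)) =o[𝓝 y] fun x => ‖x - y‖ ^ 1 := by
    simpa using (hddf y).hasFDerivAt.isLittleO.norm_right
  have := convex_univ.isLittleO_pow_succ (n := 1) (mem_univ y)
    (fun x _ => (hderiv x).hasFDerivWithinAt) (by rwa [nhdsWithin_univ])
  simpa [one_add_one_eq_two] using this

/-- Second-order expansion of `f` along the arc `t ↦ y + t • d t` where `d t → v`. -/
theorem ContDiff.taylor_two_arc {E F : Type*} [NormedAddCommGroup E] [NormedSpace ℝ E]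
    [NormedAddCommGroup F] [NormedSpace ℝ F] {f : E → F} (hf : ContDiff ℝ 2 f) (y v : E)
    {d : ℝ → E} (hd : Tendsto d (𝓝[>] 0) (𝓝 v)) :
    (fun t => f (y + t • d t) - f y - t • fderiv ℝ f y (d t)
      - t ^ 2 • (1 / 2 : ℝ) • fderiv ℝ (fderiv ℝ f) y v v) =o[𝓝[>] 0] fun t : ℝ => t ^ 2 := by
  set D := fderiv ℝ (fderiv ℝ f) y with hD
  have ht0 : Tendsto (fun t : ℝ => t) (𝓝[>] 0) (𝓝 0) := tendsto_id.mono_left nhdsWithin_le_nhds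
  have hy : Tendsto (fun t => y + t • d t) (𝓝[>] 0) (𝓝 y) := by
    simpa using tendsto_const_nhds.add (ht0.smul hd)
  have h1 := (hf.taylor_two_isLittleO y).comp_tendsto hy
  have h2 : ((fun x : E => ‖x - y‖ ^ 2) ∘ fun t => y + t • d t) =O[𝓝[>] 0] fun t : ℝ => t ^ 2 := by
    have : (fun t : ℝ => t • d t) =O[𝓝[>] 0] fun t : ℝ => t := by
      simpa using (Asymptotics.isBigO_refl (fun t : ℝ => t) (𝓝[>] 0)).smul (hd.isBigO_one ℝ)
    simpa [Function.comp_def] using this.norm_left.pow 2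
  have h3 : (fun t => t ^ 2 • ((1 / 2 : ℝ) • (D (d t) (d t) - D v v))) =o[𝓝[>] 0]
      fun t : ℝ => t ^ 2 := by
    have hlim : Tendsto (fun t => (1 / 2 : ℝ) • (D (d t) (d t) - D v v)) (𝓝[>] 0) (𝓝 0) := by
      have hc : Continuous fun u => (1 / 2 : ℝ) • (D u u - D v v) := by fun_prop
      simpa [Function.comp_def] using (hc.tendsto v).comp hd
    simpa using (Asymptotics.isBigO_refl (fun t : ℝ => t ^ 2) (𝓝[>] 0)).smul_isLittleO
      ((Asymptotics.isLittleO_one_iff ℝ).2 hlim)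
  refine ((h1.trans_isBigO h2).add h3).congr_left fun t => ?_
  simp only [Function.comp_apply, add_sub_cancel_left, map_smul, smul_apply]
  module

/-- A linear functional bounded by the positive part of an affine map is represented by a bounded
nonnegative multiplier. -/
theorem exists_bounded_multiplier {m q : ℕ} (A : Eu m →L[ℝ] Eu q) (b : Eu q) (J : Set (Fin q))
    (ys : Eu m) (s : ℝ) {K : ℝ} (hK : 0 ≤ K)
    (h : ∀ τ : ℝ, 0 ≤ τ → ∀ (w : Eu m) (p : Eu q),
      (∀ i ∈ J, A w i + τ * b i ≤ p i) → ⟪ys, w⟫ + τ * s ≤ K * ‖p‖) :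
    ∃ l : Eu q, (∀ i, 0 ≤ l i) ∧ (∀ i ∉ J, l i = 0) ∧ ‖l‖ ≤ K ∧
      ContinuousLinearMap.adjoint A l = ys ∧ s ≤ ⟪l, b⟫ := by
  classical
  let C : Set (Eu q) := {l | (∀ i, 0 ≤ l i) ∧ (∀ i ∉ J, l i = 0)} ∩ Metric.closedBall 0 K
  have hCclosed : IsClosed {l : Eu q | (∀ i, 0 ≤ l i) ∧ (∀ i ∉ J, l i = 0)} := by
    simp only [ofPred_and, ofPred_forall]
    refine IsClosed.inter (isClosed_iInter fun i => isClosed_le (by fun_prop) (by fun_prop))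
      (isClosed_iInter fun i => isClosed_iInter fun _ => isClosed_eq (by fun_prop) (by fun_prop))
  have hCcomp : IsCompact C := (isCompact_closedBall (0 : Eu q) K).inter_left hCclosed
  have hCconv : Convex ℝ C := by
    refine Convex.inter ?_ (convex_closedBall _ _)
    intro x hx z hz a c ha hc _
    refine ⟨fun i => ?_, fun i hi => ?_⟩
    · have := hx.1 i
      have := hz.1 i
      simp only [PiLp.add_apply, PiLp.smul_apply, smul_eq_mul]
      positivity
    · simp [hx.2 i hi, hz.2 i hi]
  let T : Eu q →L[ℝ] Eu m × ℝ := (ContinuousLinearMap.adjoint A).prod (innerSL ℝ b)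
  by_contra hno
  have hdisj : Disjoint (T '' C) ({ys} ×ˢ Ici s) := by
    rw [Set.disjoint_left]
    rintro _ ⟨l, hl, rfl⟩ hl'
    exact hno ⟨l, hl.1.1, hl.1.2, by simpa using hl.2, hl'.1,
      (real_inner_comm l b).symm ▸ hl'.2⟩
  obtain ⟨f, u, c, hfu, huc, hfc⟩ := geometric_hahn_banach_compact_closed
    (hCconv.linear_image T.toLinearMap) (hCcomp.image T.continuous)
    ((convex_singleton ys).prod (convex_Ici s)) (isClosed_singleton.prod isClosed_Ici) hdisj
  let τ : ℝ := f (0, 1)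
  let w : Eu m := (InnerProductSpace.toDual ℝ (Eu m)).symm
    (f.comp (ContinuousLinearMap.inl ℝ (Eu m) ℝ))
  have hf : ∀ x r, f (x, r) = ⟪x, w⟫ + r * τ := by
    intro x r
    have h1 : ⟪w, x⟫ = f (x, 0) := by
      simp [w, InnerProductSpace.toDual_symm_apply]
    rw [real_inner_comm, h1, ← smul_eq_mul, ← map_smul, ← map_add]
    simp
  have hτ : 0 ≤ τ := by
    by_contra hneg
    push Not at hneg
    let r := max s ((c - ⟪ys, w⟫) / τ)
    have h1 := hfc (ys, r) ⟨rfl, le_max_left s _⟩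
    rw [hf] at h1
    have h2 : r * τ ≤ (c - ⟪ys, w⟫) / τ * τ :=
      mul_le_mul_of_nonpos_right (le_max_right _ _) hneg.le
    rw [div_mul_cancel₀ _ hneg.ne] at h2
    linarith
  let p : Eu q := WithLp.toLp 2 fun i => if i ∈ J then max (A w i + τ * b i) 0 else 0
  have hp : ∀ i, p i = if i ∈ J then max (A w i + τ * b i) 0 else 0 := fun i => rfl
  have hpn : ∀ i, 0 ≤ p i := fun i => by rw [hp]; split_ifs <;> simp
  have hmain := h τ hτ w p (fun i hi => by simp [hp, hi])
  have hpp : ⟪p, A w + τ • b⟫ = ‖p‖ ^ 2 := by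
    rw [← real_inner_self_eq_norm_sq, PiLp.inner_apply, PiLp.inner_apply]
    refine Finset.sum_congr rfl fun i _ => ?_
    simp only [PiLp.add_apply, PiLp.smul_apply, smul_eq_mul, RCLike.inner_apply, conj_trivial, hp]
    split_ifs
    · rcases le_total (A w i + τ * b i) 0 with h0 | h0 <;> simp [h0]
    · simp
  have hlC : (K / ‖p‖) • p ∈ C := by
    refine ⟨⟨fun i => ?_, fun i hi => ?_⟩, ?_⟩
    · have := hpn i
      simp only [PiLp.smul_apply, smul_eq_mul]
      positivity
    · simp [hp, hi]
    · rw [mem_closedBall_zero_iff, norm_smul, Real.norm_of_nonneg (by positivity)]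
      rcases eq_or_ne ‖p‖ 0 with h0 | h0
      · simpa [h0] using hK
      · rw [div_mul_cancel₀ _ h0]
  have h1 := hfu _ ⟨_, hlC, rfl⟩
  have h2 := hfc (ys, s) ⟨rfl, self_mem_Ici⟩
  rw [hf] at h2
  have h3 : f (T ((K / ‖p‖) • p)) = K * ‖p‖ := by
    have : T ((K / ‖p‖) • p) =
        (ContinuousLinearMap.adjoint A ((K / ‖p‖) • p), ⟪b, (K / ‖p‖) • p⟫) := rfl
    rw [this, hf, ContinuousLinearMap.adjoint_inner_left, real_inner_comm _ b, mul_comm _ τ,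
      ← inner_smul_right, ← inner_add_right, real_inner_smul_left, hpp]
    rcases eq_or_ne ‖p‖ 0 with h0 | h0
    · simp [h0]
    · field_simp
  have h4 : f (T ((K / ‖p‖) • p)) < u := h1
  linarith

/-- Basic-solution reduction: a feasible point of a linear program in standard form can be replaced
by one whose support carries no nontrivial kernel element, with no larger coordinate sum and no
smaller optimal value. -/
theorem exists_basic_solution {q : ℕ} {F : Type*} [AddCommGroup F] [Module ℝ F]
    (M : Eu q →ₗ[ℝ] F) (b : Eu q) (J : Set (Fin q)) (ys : F) (s : ℝ)
    (hs : ∀ l : Eu q, (∀ i, 0 ≤ l i) → (∀ i ∉ J, l i = 0) → M l = ys → ⟪l, b⟫ ≤ s)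
    (l₀ : Eu q) (h0 : ∀ i, 0 ≤ l₀ i) (hJ : ∀ i ∉ J, l₀ i = 0) (hM : M l₀ = ys)
    (hv : s ≤ ⟪l₀, b⟫) :
    ∃ l : Eu q, (∀ i, 0 ≤ l i) ∧ (∀ i ∉ J, l i = 0) ∧ M l = ys ∧ s ≤ ⟪l, b⟫ ∧
      ∑ i, l i ≤ ∑ i, l₀ i ∧ ∀ μ : Eu q, (∀ i, l i = 0 → μ i = 0) → M μ = 0 → μ = 0 := by
  classical
  induction hn : (Finset.univ.filter fun i => l₀ i ≠ 0).card using Nat.strong_induction_on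
    generalizing l₀ with
  | _ n ih =>
  by_cases hμ : ∀ μ : Eu q, (∀ i, l₀ i = 0 → μ i = 0) → M μ = 0 → μ = 0
  · exact ⟨l₀, h0, hJ, hM, hv, le_rfl, hμ⟩
  push Not at hμ
  obtain ⟨μ, hμs, hμM, hμ0⟩ : ∃ μ : Eu q, (∀ i, l₀ i = 0 → μ i = 0) ∧ M μ = 0 ∧
      ∑ i, μ i ≤ 0 ∧ μ ≠ 0 := by
    obtain ⟨μ, h1, h2, h3⟩ := hμ
    rcases le_total (∑ i, μ i) 0 with h | h
    · exact ⟨μ, h1, h2, h, h3⟩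
    · exact ⟨-μ, fun i hi => by simp [h1 i hi], by simp [h2], by simpa using h, by simpa using h3⟩
  obtain ⟨hsum, hμ0⟩ := hμ0
  have hmove : ∀ r : ℝ, (∀ i, 0 ≤ l₀ i + r * μ i) → r * ⟪μ, b⟫ ≤ 0 := by
    intro r hr
    have := hs (l₀ + r • μ) (by simpa using hr)
      (fun i hi => by simp [hJ i hi, hμs i (hJ i hi)]) (by simp [hM, hμM])
    rw [inner_add_left, real_inner_smul_left] at this
    linarith
  have hneg : (Finset.univ.filter fun i => μ i < 0).Nonempty := by
    by_contra hne
    rw [Finset.not_nonempty_iff_eq_empty, Finset.filter_eq_empty_iff] at hne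
    have hnn : ∀ i ∈ Finset.univ, 0 ≤ μ i := fun i hi => not_lt.1 (hne hi)
    have := (Finset.sum_eq_zero_iff_of_nonneg hnn).1 (le_antisymm hsum (Finset.sum_nonneg hnn))
    exact hμ0 (by ext i; simpa using this i (Finset.mem_univ i))
  obtain ⟨k, hk, hmin⟩ := Finset.exists_min_image _ (fun i => l₀ i / -μ i) hneg
  rw [Finset.mem_filter] at hk
  have hkneg := hk.2
  have hpos : ∀ i, l₀ i ≠ 0 → 0 < l₀ i := fun i hi => lt_of_le_of_ne (h0 i) (Ne.symm hi)
  have hkl : 0 < l₀ k := hpos k fun h => hkneg.ne (hμs k h)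
  set r := l₀ k / -μ k with hr
  have hrpos : 0 < r := div_pos hkl (by linarith)
  have hfeas : ∀ i, 0 ≤ l₀ i + r * μ i := by
    intro i
    rcases lt_or_ge (μ i) 0 with hi | hi
    · have := hmin i (by simpa using hi)
      rw [le_div_iff₀ (by linarith)] at this
      linarith
    · have := h0 i
      positivity
  have hzero : 0 ≤ ⟪μ, b⟫ := by
    have hev : ∀ᶠ ε : ℝ in 𝓝[>] 0, ∀ i, 0 ≤ l₀ i + -ε * μ i := by
      rw [eventually_all]
      intro i
      by_cases hi : l₀ i = 0
      · simp [hi, hμs i hi]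
      · have hc : Tendsto (fun ε : ℝ => l₀ i + -ε * μ i) (𝓝[>] 0) (𝓝 (l₀ i)) := by
          have : Continuous fun ε : ℝ => l₀ i + -ε * μ i := by fun_prop
          simpa using (this.tendsto 0).mono_left nhdsWithin_le_nhds
        exact (hc.eventually (lt_mem_nhds (hpos i hi))).mono fun _ => le_of_lt
    obtain ⟨ε, hε, hε0⟩ := (hev.and self_mem_nhdsWithin).exists
    have := hmove _ hε
    replace hε0 : 0 < ε := hε0
    by_contra hlt
    push Not at hlt
    nlinarith
  have hcard : (Finset.univ.filter fun i => (l₀ + r • μ) i ≠ 0).card < n := by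
    rw [← hn]
    refine Finset.card_lt_card ⟨fun i hi => ?_, fun hsub => ?_⟩
    · rw [Finset.mem_filter] at hi ⊢
      refine ⟨hi.1, fun h => hi.2 ?_⟩
      simp [h, hμs i h]
    · have := hsub (Finset.mem_filter.2 ⟨Finset.mem_univ k, hkl.ne'⟩)
      rw [Finset.mem_filter] at this
      refine this.2 ?_
      have hne := hkneg.ne
      simp only [PiLp.add_apply, PiLp.smul_apply, smul_eq_mul, hr]
      field_simp
      ring
  obtain ⟨l, h1, h2, h3, h4, h5, h6⟩ := ih _ hcard (l₀ + r • μ) (by simpa using hfeas)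
    (fun i hi => by simp [hJ i hi, hμs i (hJ i hi)]) (by simp [hM, hμM])
    (by rw [inner_add_left, real_inner_smul_left]; nlinarith) rfl
  refine ⟨l, h1, h2, h3, h4, h5.trans ?_, h6⟩
  simp only [PiLp.add_apply, PiLp.smul_apply, smul_eq_mul, Finset.sum_add_distrib,
    ← Finset.mul_sum]
  nlinarith

/-- The constraint system `g ≤ 0` has the error bound property with constant `κ` around `y`. -/
def HasErrorBound {m q : ℕ} (g : Eu m → Eu q) (κ : ℝ) (y : Eu m) : Prop :=
  ∀ᶠ z in 𝓝 y, ∀ p : Eu q, (∀ i, g z i ≤ p i) → ∃ z' ∈ Gam g, ‖z - z'‖ ≤ κ * ‖p‖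

theorem MSCQlow.eventually_hasErrorBound {m q : ℕ} {g : Eu m → Eu q} (hg : Continuous g)
    {yb : Eu m} (hyb : yb ∈ Gam g) (h : MSCQlow g yb) :
    ∃ κ : ℝ, 0 < κ ∧ ∀ᶠ y in 𝓝 yb, HasErrorBound g κ y := by
  obtain ⟨κ, hκ, W, hW, hb⟩ := h
  refine ⟨κ, hκ, eventually_eventually_nhds.2 ?_⟩
  have hclosed : IsClosed (Gam g) := by
    simp only [Gam, ofPred_forall]
    exact isClosed_iInter fun i => isClosed_le (by fun_prop) continuous_const
  filter_upwards [hW] with z hz p hp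
  obtain ⟨z', hz', hdist⟩ := hclosed.exists_infDist_eq_dist ⟨yb, hyb⟩ z
  refine ⟨z', hz', ?_⟩
  have h1 := hb z hz
  have hset : {z' | (0 : Eu q) ∈ {w : Eu q | ∀ i, g z' i - w i ≤ 0}} = Gam g := by
    ext x; simp [Gam]
  have h2 : Metric.infEDist (0 : Eu q) {w : Eu q | ∀ i, g z i - w i ≤ 0} ≤ ENNReal.ofReal ‖p‖ := by
    have hmem : p ∈ {w : Eu q | ∀ i, g z i - w i ≤ 0} := fun i => sub_nonpos.2 (hp i)
    refine (Metric.infEDist_le_edist_of_mem hmem).trans ?_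
    rw [edist_dist, dist_zero_left]
  rw [hset] at h1
  have h3 : Metric.infEDist z (Gam g) ≤ ENNReal.ofReal (κ * ‖p‖) := by
    rw [ENNReal.ofReal_mul hκ.le]
    exact h1.trans (by gcongr; exact h2)
  rw [← dist_eq_norm, ← hdist]
  exact ENNReal.toReal_le_of_le_ofReal (by positivity) h3

theorem HasErrorBound.arc {m q : ℕ} {g : Eu m → Eu q} {κ : ℝ} {y : Eu m} (hκ : 0 ≤ κ)
    (h : HasErrorBound g κ y) {z : ℝ → Eu m} (hz : Tendsto z (𝓝[>] 0) (𝓝 y)) {φ : ℝ → ℝ}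
    (hφ : ∀ t, 0 < t → 0 ≤ φ t) {p : Eu q} {r : ℝ → Eu q} (hr : r =o[𝓝[>] 0] φ)
    (hp : ∀ᶠ t in 𝓝[>] 0, ∀ i, g (z t) i ≤ φ t * p i + r t i) {ε : ℝ} (hε : 0 < ε) :
    ∀ᶠ t in 𝓝[>] 0, ∃ z' ∈ Gam g, ‖z t - z'‖ ≤ φ t * (κ * ‖p‖ + ε) := by
  have hc : 0 < ε / (κ + 1) := by positivity
  filter_upwards [hz.eventually h, hp, hr.def hc, self_mem_nhdsWithin] with t h1 h2 h3 ht
  obtain ⟨z', hz', hd⟩ := h1 (φ t • p + r t) (by simpa using h2)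
  refine ⟨z', hz', hd.trans ?_⟩
  have hφt := hφ t ht
  rw [Real.norm_of_nonneg hφt] at h3
  have h4 : ‖φ t • p + r t‖ ≤ φ t * ‖p‖ + ε / (κ + 1) * φ t := by
    refine (norm_add_le _ _).trans (add_le_add ?_ h3)
    rw [norm_smul, Real.norm_of_nonneg hφt]
  have h5 : κ * (ε / (κ + 1)) ≤ ε := by
    rw [← mul_div_assoc, div_le_iff₀ (by positivity)]
    nlinarith
  calc κ * ‖φ t • p + r t‖ ≤ κ * (φ t * ‖p‖ + ε / (κ + 1) * φ t) := by gcongr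
    _ = φ t * (κ * ‖p‖ + κ * (ε / (κ + 1))) := by ring
    _ ≤ _ := by gcongr

theorem tendsto_id_nhdsGT_zero : Tendsto (fun t : ℝ => t) (𝓝[>] 0) (𝓝 0) :=
  tendsto_id.mono_left nhdsWithin_le_nhds

/-- First-order consequence of the error bound for regular normals. -/
theorem HasErrorBound.inner_le {m q : ℕ} {g : Eu m → Eu q} (hg : Differentiable ℝ g) {κ : ℝ}
    (hκ : 0 ≤ κ) {y : Eu m} (hy : y ∈ Gam g) (h : HasErrorBound g κ y) {ys : Eu m}
    (hys : ys ∈ rnc (Gam g) y) {w : Eu m} {p : Eu q}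
    (hp : ∀ i, g y i = 0 → fderiv ℝ g y w i ≤ p i) :
    ⟪ys, w⟫ ≤ ‖ys‖ * (κ * ‖p‖) := by
  have hlim : Tendsto (fun ε : ℝ => ε * (‖w‖ + (κ * ‖p‖ + ε)) + ‖ys‖ * (κ * ‖p‖ + ε)) (𝓝[>] 0)
      (𝓝 (‖ys‖ * (κ * ‖p‖))) := by
    have : Continuous fun ε : ℝ => ε * (‖w‖ + (κ * ‖p‖ + ε)) + ‖ys‖ * (κ * ‖p‖ + ε) := by fun_prop
    simpa using (this.tendsto 0).mono_left nhdsWithin_le_nhds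
  refine ge_of_tendsto hlim (eventually_mem_nhdsWithin.mono fun ε hε => ?_)
  replace hε : 0 < ε := hε
  have hz : Tendsto (fun t : ℝ => y + t • w) (𝓝[>] 0) (𝓝 y) := by
    simpa using tendsto_const_nhds.add (tendsto_id_nhdsGT_zero.smul_const w)
  have hr : (fun t : ℝ => g (y + t • w) - g y - t • fderiv ℝ g y w) =o[𝓝[>] 0] fun t : ℝ => t := by
    have h1 := (hg y).hasFDerivAt.isLittleO.comp_tendsto hz
    refine (h1.congr_left fun t => by simp).trans_isBigO ?_
    refine Asymptotics.IsBigO.of_bound ‖w‖ (.of_forall fun t => ?_)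
    simp [norm_smul, mul_comm]
  have hle : ∀ᶠ t : ℝ in 𝓝[>] 0, ∀ i,
      g (y + t • w) i ≤ t * p i + (g (y + t • w) - g y - t • fderiv ℝ g y w) i := by
    rw [eventually_all]
    intro i
    have heq : ∀ t : ℝ, (g (y + t • w) - g y - t • fderiv ℝ g y w) i =
        g (y + t • w) i - g y i - t * fderiv ℝ g y w i := fun t => by simp
    simp only [heq]
    rcases eq_or_ne (g y i) 0 with hi | hi
    · filter_upwards [self_mem_nhdsWithin] with t ht
      have := mul_le_mul_of_nonneg_left (hp i hi) (le_of_lt ht)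
      linarith
    · have hneg : g y i < 0 := lt_of_le_of_ne (hy i) hi
      have hc : Continuous fun t : ℝ => g y i + t * fderiv ℝ g y w i - t * p i := by fun_prop
      have := ((hc.tendsto 0).comp tendsto_id_nhdsGT_zero).eventually
        (gt_mem_nhds (show _ < 0 by simpa using hneg))
      filter_upwards [this] with t ht
      rw [Function.comp_apply] at ht
      linarith
  obtain ⟨δ, hδ, hN⟩ := hys ε hε
  have hsmall : ∀ᶠ t : ℝ in 𝓝[>] 0, t * (‖w‖ + (κ * ‖p‖ + ε)) < δ := by
    have := tendsto_id_nhdsGT_zero.mul_const (‖w‖ + (κ * ‖p‖ + ε))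
    rw [zero_mul] at this
    exact this.eventually (gt_mem_nhds hδ)
  obtain ⟨t, ⟨z', hz', hd⟩, ht, hts⟩ := ((h.arc hκ hz (φ := fun t => t) (fun _ h => h.le) hr hle
    hε).and (eventually_mem_nhdsWithin.and hsmall)).exists
  replace ht : 0 < t := ht
  have hnorm : ‖z' - y‖ ≤ t * (‖w‖ + (κ * ‖p‖ + ε)) := by
    have : z' - y = t • w - (y + t • w - z') := by abel
    rw [this]
    refine (norm_sub_le _ _).trans ?_
    rw [norm_smul, Real.norm_of_nonneg ht.le]
    linarith
  have h1 := hN z' hz' (hnorm.trans_lt hts)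
  have h2 := (real_inner_le_norm ys (y + t • w - z')).trans
    (mul_le_mul_of_nonneg_left hd (norm_nonneg ys))
  have h3 : t * ⟪ys, w⟫ = ⟪ys, z' - y⟫ + ⟪ys, y + t • w - z'⟫ := by
    rw [← inner_add_right, ← real_inner_smul_right]
    congr 1; abel
  have h4 := mul_le_mul_of_nonneg_left hnorm hε.le
  refine le_of_mul_le_mul_left ?_ ht
  linarith

theorem fderiv_apply_nonpos_of_mem_tcone {m q : ℕ} {g : Eu m → Eu q} (hg : Differentiable ℝ g)
    {y v : Eu m} (hv : v ∈ tcone (Gam g) y) {i : Fin q} (hi : g y i = 0) :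
    fderiv ℝ g y v i ≤ 0 := by
  obtain ⟨t, w, ht, ht0, hw, hmem⟩ := hv
  have h1 := (hasFDerivWithinAt_univ.2 (hg y).hasFDerivAt).lim (l := atTop)
    (c := fun k => (t k)⁻¹) (d := fun k => t k • w k) (v := v)
    (by simpa using ht0.smul hw) (by simp)
    (hw.congr fun k => by rw [smul_smul, inv_mul_cancel₀ (ht k).ne', one_smul])
  have h2 := ((EuclideanSpace.proj (𝕜 := ℝ) i).continuous.tendsto _).comp h1
  refine le_of_tendsto h2 (.of_forall fun k => ?_)
  have h3 := hmem k i
  have h4 : 0 < (t k)⁻¹ := inv_pos.2 (ht k)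
  change (t k)⁻¹ * (g (y + t k • w k) i - g y i) ≤ 0
  rw [hi, sub_zero]
  exact mul_nonpos_of_nonneg_of_nonpos h4.le h3

/-- Second-order consequence of the error bound in a critical direction. -/
theorem HasErrorBound.inner_add_le {m q : ℕ} {g : Eu m → Eu q} (hg : ContDiff ℝ 2 g) {κ : ℝ}
    (hκ : 0 ≤ κ) {y : Eu m} (hy : y ∈ Gam g) (h : HasErrorBound g κ y) {ys v : Eu m}
    (hv : v ∈ Kcone g y ys) {l : Eu q} (hl : l ∈ Lam g y ys) {w : Eu m} {p b : Eu q}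
    (hb : b = (1 / 2 : ℝ) • fderiv ℝ (fderiv ℝ g) y v v)
    (hp : ∀ i, g y i = 0 → fderiv ℝ g y w i + b i ≤ p i) :
    ⟪ys, w⟫ + ⟪l, b⟫ ≤ ‖ys‖ * (κ * ‖p‖) := by
  have hdiff : Differentiable ℝ g := hg.differentiable (by norm_num)
  have hlim : Tendsto (fun ε : ℝ => ‖ys‖ * (κ * ‖p‖ + ε) + ‖l‖ * ε) (𝓝[>] 0)
      (𝓝 (‖ys‖ * (κ * ‖p‖))) := by
    have : Continuous fun ε : ℝ => ‖ys‖ * (κ * ‖p‖ + ε) + ‖l‖ * ε := by fun_prop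
    simpa using (this.tendsto 0).mono_left nhdsWithin_le_nhds
  refine ge_of_tendsto hlim (eventually_mem_nhdsWithin.mono fun ε hε => ?_)
  replace hε : 0 < ε := hε
  set A := fderiv ℝ g y
  have hd : Tendsto (fun t : ℝ => v + t • w) (𝓝[>] 0) (𝓝 v) := by
    simpa using tendsto_const_nhds.add (tendsto_id_nhdsGT_zero.smul_const w)
  have hz : Tendsto (fun t : ℝ => y + t • (v + t • w)) (𝓝[>] 0) (𝓝 y) := by
    simpa using tendsto_const_nhds.add (tendsto_id_nhdsGT_zero.smul hd)
  have hr := hg.taylor_two_arc y v hd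
  rw [← hb] at hr
  have hle : ∀ᶠ t : ℝ in 𝓝[>] 0, ∀ i, g (y + t • (v + t • w)) i ≤ t ^ 2 * p i +
      (g (y + t • (v + t • w)) - g y - t • A (v + t • w) - t ^ 2 • b) i := by
    rw [eventually_all]
    intro i
    have heq : ∀ t : ℝ, (g (y + t • (v + t • w)) - g y - t • A (v + t • w) - t ^ 2 • b) i =
        g (y + t • (v + t • w)) i - g y i - t * (A v i + t * A w i) - t ^ 2 * b i :=
      fun t => by simp [mul_add]
    simp only [heq]
    rcases eq_or_ne (g y i) 0 with hi | hi
    · filter_upwards [self_mem_nhdsWithin] with t ht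
      have h1 := mul_le_mul_of_nonneg_left (hp i hi) (sq_nonneg t)
      have h2 := mul_nonpos_of_nonneg_of_nonpos (le_of_lt ht)
        (fderiv_apply_nonpos_of_mem_tcone hdiff hv.1 hi)
      linarith
    · have hneg : g y i < 0 := lt_of_le_of_ne (hy i) hi
      have hc : Continuous fun t : ℝ =>
        g y i + t * (A v i + t * A w i) + t ^ 2 * b i - t ^ 2 * p i := by fun_prop
      have := ((hc.tendsto 0).comp tendsto_id_nhdsGT_zero).eventually
        (gt_mem_nhds (show _ < 0 by simpa using hneg))
      filter_upwards [this] with t ht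
      rw [Function.comp_apply] at ht
      linarith
  obtain ⟨z', hz'⟩ := (h.arc hκ hz (fun t _ => sq_nonneg t) hr hle hε).choice
  have hd' : Tendsto (fun t : ℝ => t⁻¹ • (z' t - y)) (𝓝[>] 0) (𝓝 v) := by
    rw [tendsto_iff_norm_sub_tendsto_zero] at hd ⊢
    have hup : Tendsto (fun t : ℝ => t * (κ * ‖p‖ + ε) + ‖v + t • w - v‖) (𝓝[>] 0) (𝓝 0) := by
      simpa using (tendsto_id_nhdsGT_zero.mul_const (κ * ‖p‖ + ε)).add hd
    refine squeeze_zero' (.of_forall fun t => norm_nonneg _) ?_ hup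
    filter_upwards [hz', self_mem_nhdsWithin] with t ht ht0
    replace ht0 : 0 < t := ht0
    have heq : t⁻¹ • (z' t - y) - v =
        -(t⁻¹ • (y + t • (v + t • w) - z' t)) + (v + t • w - v) := by
      have : y + t • (v + t • w) - z' t = t • (v + t • w) - (z' t - y) := by abel
      rw [this, smul_sub t⁻¹ (t • _), smul_smul, inv_mul_cancel₀ ht0.ne', one_smul]
      abel
    rw [heq]
    refine (norm_add_le _ _).trans (add_le_add ?_ le_rfl)
    rw [norm_neg, norm_smul, Real.norm_of_nonneg (inv_nonneg.2 ht0.le), inv_mul_le_iff₀ ht0]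
    exact ht.2.trans_eq (by ring)
  have hr' := hg.taylor_two_arc y v hd'
  rw [← hb] at hr'
  obtain ⟨t, ⟨hzt, hdt⟩, hrt, ht⟩ := (hz'.and ((hr'.def hε).and eventually_mem_nhdsWithin)).exists
  replace ht : 0 < t := ht
  have hzy : y + t • t⁻¹ • (z' t - y) = z' t := by
    rw [smul_smul, mul_inv_cancel₀ ht.ne', one_smul]; abel
  have hAz : t • A (t⁻¹ • (z' t - y)) = A (z' t - y) := by
    rw [map_smul, smul_smul, mul_inv_cancel₀ ht.ne', one_smul]
  rw [hzy, hAz, Real.norm_of_nonneg (sq_nonneg t)] at hrt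
  have hgl : ⟪l, g (z' t)⟫ ≤ 0 := by
    rw [PiLp.inner_apply]
    refine Finset.sum_nonpos fun i _ => ?_
    simpa [mul_comm] using mul_nonpos_of_nonneg_of_nonpos (hl.1 i) (hzt i)
  have hgy : ⟪l, g y⟫ = 0 := by
    rw [PiLp.inner_apply]
    refine Finset.sum_eq_zero fun i _ => ?_
    by_cases hi : g y i = 0
    · simp [hi]
    · simp [hl.2.2 i hi]
  have hlA : ∀ x, ⟪l, A x⟫ = ⟪ys, x⟫ := fun x => by
    rw [← hl.2.1, ContinuousLinearMap.adjoint_inner_left]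
  have h1 := (neg_le_of_abs_le (abs_real_inner_le_norm l
    (g (z' t) - g y - A (z' t - y) - t ^ 2 • b))).trans'
      (neg_le_neg (mul_le_mul_of_nonneg_left hrt (norm_nonneg l)))
  rw [inner_sub_right, inner_sub_right, inner_sub_right, hgy, hlA, real_inner_smul_right] at h1
  have h2 := (real_inner_le_norm ys (y + t • (v + t • w) - z' t)).trans
    (mul_le_mul_of_nonneg_left hdt (norm_nonneg ys))
  have h3 : t ^ 2 * ⟪ys, w⟫ = ⟪ys, z' t - y⟫ + ⟪ys, y + t • (v + t • w) - z' t⟫ := by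
    have hvy : ⟪ys, v⟫ = 0 := by rw [real_inner_comm]; exact hv.2
    have : z' t - y + (y + t • (v + t • w) - z' t) = t • v + t ^ 2 • w := by module
    rw [← inner_add_right, this, inner_add_right, real_inner_smul_right, real_inner_smul_right,
      hvy]
    ring
  refine le_of_mul_le_mul_left ?_ (pow_pos ht 2)
  linarith

theorem inner_hessA {m q : ℕ} {g : Eu m → Eu q} (hg : ContDiff ℝ 2 g) (l : Eu q) (y v : Eu m) :
    ⟪v, hessA g l y v⟫ = ⟪l, fderiv ℝ (fderiv ℝ g) y v v⟫ := by
  let Φ : (Eu m →L[ℝ] Eu q) →L[ℝ] Eu m := LinearMap.toContinuousLinearMap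
    { toFun := fun T => ContinuousLinearMap.adjoint T l
      map_add' := fun S T => by simp
      map_smul' := fun c T => by simp }
  have hddf : Differentiable ℝ (fderiv ℝ g) :=
    (hg.fderiv_right (m := 1) (by norm_num)).differentiable (by norm_num)
  have h1 : hessA g l y v = Φ (fderiv ℝ (fderiv ℝ g) y v) := by
    have := (Φ.hasFDerivAt.comp y (hddf y).hasFDerivAt).fderiv
    change fderiv ℝ (Φ ∘ fderiv ℝ g) y v = _
    rw [this]
    rfl
  have h2 : Φ (fderiv ℝ (fderiv ℝ g) y v) =
    ContinuousLinearMap.adjoint (fderiv ℝ (fderiv ℝ g) y v) l := rfl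
  rw [h1, h2, ContinuousLinearMap.adjoint_inner_right, real_inner_comm]

theorem EuclideanSpace.norm_le_sum_of_nonneg {q : ℕ} {l : Eu q} (hl : ∀ i, 0 ≤ l i) :
    ‖l‖ ≤ ∑ i, l i := by
  have hsum : 0 ≤ ∑ i, l i := Finset.sum_nonneg fun i _ => hl i
  rw [EuclideanSpace.norm_eq, Real.sqrt_le_left hsum]
  simpa using Finset.sum_sq_le_sq_sum_of_nonneg fun i _ => hl i

/-- If the kernel of the adjoint meets the vectors supported on `I⁺(l)` trivially, then the
gradients indexed by `I⁺(l)` are linearly independent. -/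
theorem linearIndependent_fderiv_of_adjoint {m q : ℕ} {g : Eu m → Eu q} {y : Eu m}
    (hg : DifferentiableAt ℝ g y) {l : Eu q}
    (h : ∀ μ : Eu q, (∀ i, l i = 0 → μ i = 0) →
      ContinuousLinearMap.adjoint (fderiv ℝ g y) μ = 0 → μ = 0) :
    LinearIndependent ℝ (fun i : {i : Fin q // 0 < l i} =>
      fderiv ℝ (fun y' => g y' i.1) y) := by
  classical
  rw [Fintype.linearIndependent_iff]
  intro c hc i
  let μ : Eu q := WithLp.toLp 2 fun j => if hj : 0 < l j then c ⟨j, hj⟩ else 0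
  have hμ : ∀ j, μ j = if hj : 0 < l j then c ⟨j, hj⟩ else 0 := fun j => rfl
  have hgrad : ∀ j w, fderiv ℝ (fun y' => g y' j) y w = fderiv ℝ g y w j := by
    intro j w
    have := ((EuclideanSpace.proj (𝕜 := ℝ) j).hasFDerivAt.comp y hg.hasFDerivAt).fderiv
    change fderiv ℝ (EuclideanSpace.proj (𝕜 := ℝ) j ∘ g) y w = _
    rw [this]
    rfl
  have h0 := h μ (fun j hj => by simp [hμ, hj]) ?_
  · have := congrArg (fun x : Eu q => x i.1) h0
    simpa [hμ, i.2] using this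
  · refine ext_inner_right ℝ fun w => ?_
    rw [ContinuousLinearMap.adjoint_inner_left, inner_zero_left, PiLp.inner_apply]
    have h1 := congrArg (fun T : Eu m →L[ℝ] ℝ => T w) hc
    simp only [sum_apply, smul_apply, hgrad, smul_eq_mul, zero_apply] at h1
    have h2 : ∑ j : {j // 0 < l j}, μ j * fderiv ℝ g y w j = ∑ j, μ j * fderiv ℝ g y w j := by
      rw [← Finset.sum_subtype (Finset.univ.filter fun j => 0 < l j) (by simp)
        fun j => μ j * fderiv ℝ g y w j]
      exact Finset.sum_filter_of_ne fun j _ hj => by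
        by_contra hlj; exact hj (by simp [hμ, hlj])
    simp only [RCLike.inner_apply, conj_trivial, mul_comm _ (μ _)]
    rw [← h2, ← h1]
    exact Finset.sum_congr rfl fun j _ => by simp [hμ, j.2]

/-- under MSCQ for `g(y) ≤ 0` at `ȳ ∈ Γ`, there is `κ' > 0` such that for
all `y ∈ Γ` sufficiently close to `ȳ`, all `y* ∈ N̂_Γ(y)` and all critical directions
`v ∈ K(y, y*)`, the set `Λ(y, y*; v) ∩ E(y, y*) ∩ κ'‖y*‖𝔹` is nonempty. -/
theorem stmt_17 {m q : ℕ} (g : Eu m → Eu q) (hg : ContDiff ℝ 2 g)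
    (yb : Eu m) (hyb : yb ∈ Gam g) (hMSCQ : MSCQlow g yb) :
    ∃ κ' : ℝ, 0 < κ' ∧ ∃ V ∈ 𝓝 yb, ∀ y ∈ V, y ∈ Gam g →
      ∀ ys ∈ rnc (Gam g) y, ∀ v ∈ Kcone g y ys,
        ∃ l, l ∈ dirLam g y ys v ∧ l ∈ ExtPts g y ys ∧ ‖l‖ ≤ κ' * ‖ys‖ := by
  obtain ⟨κ, hκ, hV⟩ := hMSCQ.eventually_hasErrorBound hg.continuous hyb
  have hdiff : Differentiable ℝ g := hg.differentiable (by norm_num)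
  refine ⟨q * κ + 1, by positivity, _, hV, fun y hy hyG ys hys v hv => ?_⟩
  replace hy : HasErrorBound g κ y := hy
  set A := fderiv ℝ g y
  let J : Set (Fin q) := {i | g y i = 0}
  let b : Eu q := (1 / 2 : ℝ) • fderiv ℝ (fderiv ℝ g) y v v
  have hK : 0 ≤ ‖ys‖ * κ := by positivity
  have hhess : ∀ l, ⟪v, hessA g l y v⟫ = 2 * ⟪l, b⟫ := by
    intro l
    rw [inner_hessA hg, real_inner_smul_right]
    ring
  have hmem : ∀ l : Eu q, (∀ i, 0 ≤ l i) → (∀ i ∉ J, l i = 0) →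
      ContinuousLinearMap.adjoint A l = ys → l ∈ Lam g y ys := fun l h1 h2 h3 => ⟨h1, h3, h2⟩
  obtain ⟨l₁, hl₁, hl₁J, -, hl₁A, -⟩ := exists_bounded_multiplier A 0 J ys 0 hK
    fun τ _ w p hp => by
      have := hy.inner_le hdiff hκ.le hyG hys (w := w) (p := p) fun i hi => by simpa using hp i hi
      linarith
  let S : Set ℝ := (fun l => ⟪l, b⟫) '' Lam g y ys
  have hSne : S.Nonempty := ⟨_, l₁, hmem l₁ hl₁ hl₁J hl₁A, rfl⟩
  have hSle : ∀ (w : Eu m) (p : Eu q), (∀ i ∈ J, A w i + b i ≤ p i) →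
      ∀ x ∈ S, x ≤ ‖ys‖ * (κ * ‖p‖) - ⟪ys, w⟫ := by
    rintro w p hp _ ⟨l, hl, rfl⟩
    exact le_sub_iff_add_le'.2 (hy.inner_add_le hg hκ.le hyG hv hl rfl hp)
  have hSbdd : BddAbove S := ⟨_, hSle 0 b fun i _ => by simp⟩
  obtain ⟨l₂, hl₂, hl₂J, hl₂n, hl₂A, hl₂b⟩ := exists_bounded_multiplier A b J ys (sSup S) hK
    fun τ hτ w p hp => by
      rcases hτ.eq_or_lt with rfl | hτ
      · have := hy.inner_le hdiff hκ.le hyG hys (w := w) (p := p) fun i hi => by simpa using hp i hi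
        linarith
      · have h1 := csSup_le hSne (hSle (τ⁻¹ • w) (τ⁻¹ • p) fun i hi => by
          have := mul_le_mul_of_nonneg_left (hp i hi) (inv_nonneg.2 hτ.le)
          rw [mul_add, inv_mul_cancel_left₀ hτ.ne'] at this
          simpa using this)
        rw [norm_smul, Real.norm_of_nonneg (inv_nonneg.2 hτ.le), real_inner_smul_right] at h1
        have h2 := mul_le_mul_of_nonneg_left h1 hτ.le
        have h3 : τ * (‖ys‖ * (κ * (τ⁻¹ * ‖p‖)) - τ⁻¹ * ⟪ys, w⟫) =
            ‖ys‖ * κ * ‖p‖ - ⟪ys, w⟫ := by field_simp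
        linarith
  obtain ⟨l, hl, hlJ, hlA, hlb, hlsum, hli⟩ := exists_basic_solution
    (ContinuousLinearMap.adjoint A).toLinearMap b J ys (sSup S)
    (fun l h1 h2 h3 => le_csSup hSbdd ⟨l, hmem l h1 h2 h3, rfl⟩) l₂ hl₂ hl₂J hl₂A hl₂b
  have hlΛ : l ∈ Lam g y ys := hmem l hl hlJ hlA
  refine ⟨l, ⟨hlΛ, fun l' hl' => ?_⟩,
    ⟨hlΛ, linearIndependent_fderiv_of_adjoint (hdiff y) hli⟩, ?_⟩
  · have := le_csSup hSbdd ⟨l', hl', rfl⟩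
    rw [hhess, hhess]
    linarith
  · have h1 : ∑ i, l₂ i ≤ q * (‖ys‖ * κ) := by
      have := Finset.sum_le_card_nsmul Finset.univ (fun i => l₂ i) (‖ys‖ * κ) fun i _ =>
        (le_abs_self _).trans ((PiLp.norm_apply_le l₂ i).trans hl₂n)
      simpa using this
    have h2 := EuclideanSpace.norm_le_sum_of_nonneg hl
    have := norm_nonneg ys
    linarith
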